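/- arXiv:2504.02562 — 6 statements merged into one kernel-verified Lean document; each statement's English description precedes it below -/
import Mathlib

section
/- Let n ≥ 1, let H, L be real n×n matrices, F a real n×1 matrix, α a real number, and set G = H + αL. Assume the controllability matrix [F, GF, …, G^{n−1}F] is invertible. Then for any real numbers λ_1, …, λ_n there exists a real 1×n matrix K_v such that for every pair of indices i ≤ j there exists a nonzero symmetric real n×n matrix X satisfying (H + αL + F K_v) X (H + αL + F K_v)ᵀ + α² X = (λ_i λ_j + α²) X. That is, each value μ = λ_i λ_j + α² (i ≤ j) belongs to the spectrum of the closed-loop operator of the discrete-time stochastic system under the gains K_u = αI and K_v. -/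
open Matrix

section Helpers

variable {n : ℕ} {G : Matrix (Fin n) (Fin n) ℝ} {F : Matrix (Fin n) (Fin 1) ℝ}
  {W : Matrix (Fin 1) (Fin n) ℝ}

/-- Feedback does not change `W * G ^ j` as long as `W` annihilates the earlier
controllability columns. -/
theorem mul_pow_add_feedback (hW : ∀ j, j + 1 < n → W * G ^ j * F = 0)
    (K : Matrix (Fin 1) (Fin n) ℝ) (j : ℕ) (hj : j < n) :
    W * (G + F * K) ^ j = W * G ^ j := by
  induction j with
  | zero => simp
  | succ j ih =>
    rw [pow_succ, ← Matrix.mul_assoc, ih (by lia), Matrix.mul_add, ← Matrix.mul_assoc, hW j hj,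
      Matrix.zero_mul, add_zero, pow_succ, Matrix.mul_assoc]

theorem mul_aeval_add_feedback (hW : ∀ j, j + 1 < n → W * G ^ j * F = 0)
    (K : Matrix (Fin 1) (Fin n) ℝ) (q : Polynomial ℝ) (hq : q.natDegree < n) :
    W * Polynomial.aeval (G + F * K) q = W * Polynomial.aeval G q := by
  rw [Polynomial.aeval_eq_sum_range, Polynomial.aeval_eq_sum_range, Matrix.mul_sum,
    Matrix.mul_sum]
  refine Finset.sum_congr rfl fun j hj => ?_
  rw [Matrix.mul_smul, Matrix.mul_smul, mul_pow_add_feedback hW]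
  have := Finset.mem_range.mp hj
  lia

theorem mul_aeval_mul_of_monic (hW : ∀ j, j + 1 < n → W * G ^ j * F = 0)
    (hW' : ∀ j, j + 1 = n → W * G ^ j * F = 1) (q : Polynomial ℝ) (hm : q.Monic)
    (hq : q.natDegree + 1 = n) : W * Polynomial.aeval G q * F = 1 := by
  rw [Polynomial.aeval_eq_sum_range, Matrix.mul_sum, Matrix.sum_mul, Finset.sum_range_succ,
    Finset.sum_eq_zero, zero_add, Matrix.mul_smul, Matrix.smul_mul, hW' _ hq, hm.coeff_natDegree,
    one_smul]
  intro j hj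
  have := Finset.mem_range.mp hj
  rw [Matrix.mul_smul, Matrix.smul_mul, hW j (by lia), smul_zero]

theorem exists_row_of_isUnit_controllability (hn : 1 ≤ n)
    (h : IsUnit (Matrix.of fun i j : Fin n => ((G ^ (j : ℕ)) * F) i 0)) :
    ∃ W : Matrix (Fin 1) (Fin n) ℝ, (∀ j, j + 1 < n → W * G ^ j * F = 0) ∧
      ∀ j, j + 1 = n → W * G ^ j * F = 1 := by
  obtain ⟨w, hw⟩ := Matrix.vecMul_surjective_iff_isUnit.mpr h
    (Pi.single (⟨n - 1, by lia⟩ : Fin n) 1)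
  have key : ∀ (j : Fin n) (a b : Fin 1), (Matrix.of (fun _ : Fin 1 => w) * G ^ (j : ℕ) * F) a b =
      (Pi.single (⟨n - 1, by lia⟩ : Fin n) 1 : Fin n → ℝ) j := by
    intro j a b
    rw [← hw, Matrix.mul_assoc, Matrix.mul_apply, Subsingleton.elim b 0]
    rfl
  refine ⟨Matrix.of fun _ => w, fun j hj => ?_, fun j hj => ?_⟩
  · ext a b
    rw [key ⟨j, by lia⟩ a b, Pi.single_eq_of_ne, Matrix.zero_apply]
    intro h
    have := congrArg Fin.val h
    simp only at this
    lia
  · ext a b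
    have hj' : (⟨j, by lia⟩ : Fin n) = ⟨n - 1, by lia⟩ := Fin.ext (by simp only; lia)
    rw [key ⟨j, by lia⟩ a b, hj', Pi.single_eq_same, Subsingleton.elim a b, Matrix.one_apply_eq]

/-- Ackermann's formula: a controllable pair admits a gain for which all prescribed
real numbers are eigenvalues of the closed-loop matrix. -/
theorem exists_gain_eigenvector (hn : 1 ≤ n)
    (h : IsUnit (Matrix.of fun i j : Fin n => ((G ^ (j : ℕ)) * F) i 0)) (lam : Fin n → ℝ) :
    ∃ K : Matrix (Fin 1) (Fin n) ℝ, ∀ i, ∃ v : Fin n → ℝ, v ≠ 0 ∧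
      (G + F * K) *ᵥ v = lam i • v := by
  obtain ⟨W, hW, hW'⟩ := exists_row_of_isUnit_controllability hn h
  set p : Polynomial ℝ := ∏ k, (Polynomial.X - Polynomial.C (lam k)) with hp
  set K := -(W * Polynomial.aeval G p) with hK
  refine ⟨K, fun i => ?_⟩
  set q : Polynomial ℝ := ∏ k ∈ Finset.univ.erase i, (Polynomial.X - Polynomial.C (lam k)) with hq
  have hpq : p = q * (Polynomial.X - Polynomial.C (lam i)) :=
    (Finset.prod_erase_mul _ _ (Finset.mem_univ i)).symm
  have hm : q.Monic := Polynomial.monic_prod_X_sub_C _ _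
  have hdeg : q.natDegree + 1 = n := by
    rw [hq, Polynomial.natDegree_finsetProd_X_sub_C_eq_card,
      Finset.card_erase_of_mem (Finset.mem_univ i), Finset.card_univ, Fintype.card_fin]
    lia
  have h1 := mul_aeval_mul_of_monic hW hW' q hm hdeg
  have hzero : W * Polynomial.aeval G q * (G + F * K - lam i • 1) = 0 := by
    have e : G + F * K - lam i • 1 = (G - lam i • 1) + F * K := by abel
    have e' : Polynomial.aeval G p = Polynomial.aeval G q * (G - lam i • 1) := by
      rw [hpq, map_mul, map_sub, Polynomial.aeval_X, Polynomial.aeval_C,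
        Algebra.algebraMap_eq_smul_one]
    rw [e, Matrix.mul_add, ← Matrix.mul_assoc _ F K, h1, Matrix.one_mul, hK, e', Matrix.mul_assoc,
      add_neg_cancel]
  have hdet : (G + F * K - lam i • 1).det = 0 := by
    refine Matrix.exists_vecMul_eq_zero_iff.mp ⟨(W * Polynomial.aeval G q) 0, fun h0 => ?_, ?_⟩
    · have := congrFun (congrFun h1 0) 0
      rw [Matrix.mul_apply, h0] at this
      simp at this
    · exact congrFun hzero 0
  obtain ⟨v, hv, hv'⟩ := Matrix.exists_mulVec_eq_zero_iff.mpr hdet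
  refine ⟨v, hv, ?_⟩
  rwa [Matrix.sub_mulVec, Matrix.smul_mulVec, Matrix.one_mulVec, sub_eq_zero] at hv'

theorem vecMulVec_add_vecMulVec_ne_zero {u v : Fin n → ℝ} (hu : u ≠ 0) (hv : v ≠ 0) :
    vecMulVec u v + vecMulVec v u ≠ 0 := by
  intro h
  have e : ∀ a b, u a * v b + v a * u b = 0 := fun a b => congrFun (congrFun h a) b
  obtain ⟨a, ha⟩ := Function.ne_iff.mp hu
  obtain ⟨b, hb⟩ := Function.ne_iff.mp hv
  simp only [Pi.zero_apply] at ha hb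
  have hva : v a = 0 := by
    have := e a a
    have : u a * v a = 0 := by linarith
    exact (mul_eq_zero.mp this).resolve_left ha
  have := e a b
  rw [hva, zero_mul, add_zero] at this
  exact (mul_ne_zero ha hb) this

end Helpers

/-- Under controllability of (G, F) with G = H + αL, for any real
λ₁, …, λₙ there is a gain K_v such that every μ = λᵢλⱼ + α² (i ≤ j) belongs to the
spectrum of the discrete-time closed-loop operator with K_u = αI. -/
theorem discrete_alpha_spectrum_assignment
    (n : ℕ) (hn : 1 ≤ n)
    (H L : Matrix (Fin n) (Fin n) ℝ) (F : Matrix (Fin n) (Fin 1) ℝ) (α : ℝ)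
    (hctrb : IsUnit (Matrix.of fun i j : Fin n => (((H + α • L) ^ (j : ℕ)) * F) i 0)) :
    ∀ lam : Fin n → ℝ, ∃ Kv : Matrix (Fin 1) (Fin n) ℝ,
      ∀ i j : Fin n, i ≤ j → ∃ X : Matrix (Fin n) (Fin n) ℝ,
        X ≠ 0 ∧ Xᵀ = X ∧
        (H + α • L + F * Kv) * X * (H + α • L + F * Kv)ᵀ + (α ^ 2) • X
          = (lam i * lam j + α ^ 2) • X := by
  intro lam
  obtain ⟨K, hK⟩ := exists_gain_eigenvector hn hctrb lam
  refine ⟨K, fun i j _ => ?_⟩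
  obtain ⟨u, hu, hu'⟩ := hK i
  obtain ⟨v, hv, hv'⟩ := hK j
  refine ⟨vecMulVec u v + vecMulVec v u, vecMulVec_add_vecMulVec_ne_zero hu hv, ?_, ?_⟩
  · rw [Matrix.transpose_add, Matrix.transpose_vecMulVec, Matrix.transpose_vecMulVec, add_comm]
  · rw [add_smul, Matrix.mul_add, Matrix.add_mul, Matrix.mul_vecMulVec, Matrix.mul_vecMulVec,
      Matrix.vecMulVec_mul, Matrix.vecMulVec_mul, Matrix.vecMul_transpose, Matrix.vecMul_transpose,
      hu', hv']
    congr 1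
    ext a b
    simp only [Matrix.add_apply, Matrix.smul_apply, vecMulVec_apply, Pi.smul_apply, smul_eq_mul]
    ring
end

section
/- Let n ≥ 1, let H, L be real n×n matrices, F a real n×1 matrix, α a real number, and set G = H + αL. Assume the controllability matrix [F, GF, …, G^{n−1}F] is invertible. Then for any real numbers λ_1, …, λ_n there exists a real 1×n matrix T_v such that for every pair of indices i ≤ j there exists a nonzero symmetric real n×n matrix X satisfying (H + αL + F T_v) X + X (H + αL + F T_v)ᵀ + α² X = (λ_i + λ_j + α²) X. That is, each value μ = λ_i + λ_j + α² (i ≤ j) belongs to the spectrum of the closed-loop operator of the continuous-time stochastic system under the gains T_u = αI and T_v. -/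
open Matrix

/-- Two nonzero vectors have a nonzero symmetrized outer product. -/
theorem vecMulVec_add_swap_ne_zero {ι : Type*} {v w : ι → ℝ} (hv : v ≠ 0) (hw : w ≠ 0) :
    vecMulVec v w + vecMulVec w v ≠ 0 := by
  intro h
  obtain ⟨a, ha⟩ := Function.ne_iff.mp hv
  have entry : ∀ b c, v b * w c + w b * v c = 0 := fun b c => by
    simpa [vecMulVec_apply] using congrFun (congrFun h b) c
  have hwa : w a = 0 := by
    have h2 : v a * w a = 0 := by linarith [entry a a]
    exact (mul_eq_zero.mp h2).resolve_left ha
  apply hw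
  funext b
  have h3 := entry a b
  rw [hwa, zero_mul, add_zero] at h3
  exact (mul_eq_zero.mp h3).resolve_left ha

section Feedback

variable {ι : Type*} [Fintype ι] [DecidableEq ι]

theorem vecMul_aeval (A : Matrix ι ι ℝ) (q : ι → ℝ) {r : Polynomial ℝ} {m : ℕ}
    (hr : r.natDegree ≤ m) :
    q ᵥ* Polynomial.aeval A r = ∑ k ∈ Finset.range (m + 1), r.coeff k • (q ᵥ* A ^ k) := by
  rw [Polynomial.aeval_eq_sum_range' (Nat.lt_succ_of_le hr), vecMul_sum]
  simp only [vecMul_smul]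

/-- A rank-one perturbation in the direction `f` is not seen by the first Krylov vectors of a
row vector `q` that annihilates the first vectors `A ^ k *ᵥ f`. -/
theorem vecMul_pow_sub_vecMulVec (A : Matrix ι ι ℝ) (q f t : ι → ℝ) {m : ℕ}
    (h0 : ∀ k < m, (q ᵥ* A ^ k) ⬝ᵥ f = 0) {k : ℕ} (hk : k ≤ m) :
    q ᵥ* (A - vecMulVec f t) ^ k = q ᵥ* A ^ k := by
  induction k with
  | zero => simp
  | succ k ih =>
    rw [pow_succ, ← vecMul_vecMul, ih (by omega), vecMul_sub, vecMul_vecMulVec, h0 k (by omega),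
      vecMul_vecMul, ← pow_succ]
    simp

/-- Ackermann's formula: the feedback row `q ᵥ* p(A)` makes every root of `p` an eigenvalue. -/
theorem exists_eigenvector_ackermann (A : Matrix ι ι ℝ) (q f : ι → ℝ) {m : ℕ}
    (h0 : ∀ k < m, (q ᵥ* A ^ k) ⬝ᵥ f = 0) (h1 : (q ᵥ* A ^ m) ⬝ᵥ f = 1)
    {p : Polynomial ℝ} (hp : p.Monic) (hdeg : p.natDegree = m + 1) {c : ℝ} (hc : p.IsRoot c) :
    ∃ v ≠ 0, (A - vecMulVec f (q ᵥ* Polynomial.aeval A p)) *ᵥ v = c • v := by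
  set M := A - vecMulVec f (q ᵥ* Polynomial.aeval A p) with hM
  obtain ⟨r, rfl⟩ := Polynomial.dvd_iff_isRoot.mpr hc
  have hr : r.Monic := (Polynomial.monic_X_sub_C c).of_mul_monic_left hp
  have hrd : r.natDegree = m := by
    rw [(Polynomial.monic_X_sub_C c).natDegree_mul hr, Polynomial.natDegree_X_sub_C] at hdeg
    omega
  have hwf : (q ᵥ* Polynomial.aeval A r) ⬝ᵥ f = 1 := by
    rw [vecMul_aeval A q hrd.le, sum_dotProduct, Finset.sum_range_succ, Finset.sum_eq_zero]
    · rw [smul_dotProduct, h1, ← hrd, hr.coeff_natDegree]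
      simp
    · intro k hk
      rw [smul_dotProduct, h0 k (Finset.mem_range.mp hk), smul_zero]
  set w := q ᵥ* Polynomial.aeval A r with hw
  have hw0 : w ≠ 0 := by
    intro h
    simp [h] at hwf
  have hleft : w ᵥ* (M - c • (1 : Matrix ι ι ℝ)) = 0 := by
    have hA : q ᵥ* Polynomial.aeval A ((Polynomial.X - Polynomial.C c) * r)
        = w ᵥ* A - c • w := by
      rw [mul_comm, map_mul, ← vecMul_vecMul, map_sub, Polynomial.aeval_X, Polynomial.aeval_C,
        Algebra.algebraMap_eq_smul_one, vecMul_sub, vecMul_smul, vecMul_one]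
    rw [hM, vecMul_sub, vecMul_sub, vecMul_vecMulVec, hwf, hA, vecMul_smul, vecMul_one]
    simp
  obtain ⟨v, hv, hMv⟩ := exists_mulVec_eq_zero_iff.mpr
    (exists_vecMul_eq_zero_iff.mp ⟨w, hw0, hleft⟩)
  refine ⟨v, hv, ?_⟩
  rwa [sub_mulVec, smul_mulVec, one_mulVec, sub_eq_zero] at hMv

end Feedback

/-- Under controllability of (G, F) with G = H + αL, for any real
λ₁, …, λₙ there is a gain T_v such that every μ = λᵢ + λⱼ + α² (i ≤ j) belongs to the
spectrum of the continuous-time closed-loop operator with T_u = αI. -/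
theorem continuous_alpha_spectrum_assignment
    (n : ℕ) (hn : 1 ≤ n)
    (H L : Matrix (Fin n) (Fin n) ℝ) (F : Matrix (Fin n) (Fin 1) ℝ) (α : ℝ)
    (hctrb : IsUnit (Matrix.of fun i j : Fin n => (((H + α • L) ^ (j : ℕ)) * F) i 0)) :
    ∀ lam : Fin n → ℝ, ∃ Tv : Matrix (Fin 1) (Fin n) ℝ,
      ∀ i j : Fin n, i ≤ j → ∃ X : Matrix (Fin n) (Fin n) ℝ,
        X ≠ 0 ∧ Xᵀ = X ∧
        (H + α • L + F * Tv) * X + X * (H + α • L + F * Tv)ᵀ + (α ^ 2) • X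
          = (lam i + lam j + α ^ 2) • X := by
  intro lam
  obtain ⟨m, rfl⟩ : ∃ m, n = m + 1 := ⟨n - 1, by omega⟩
  set G := H + α • L
  set f : Fin (m + 1) → ℝ := fun i => F i 0 with hf
  obtain ⟨q, hq⟩ := vecMul_surjective_iff_isUnit.mpr hctrb (Pi.single (Fin.last m) 1)
  have hqk : ∀ k : Fin (m + 1),
      (q ᵥ* G ^ (k : ℕ)) ⬝ᵥ f = (Pi.single (Fin.last m) 1 : Fin (m + 1) → ℝ) k := by
    intro k
    rw [← hq, ← dotProduct_mulVec]
    rfl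
  have h0 : ∀ k < m, (q ᵥ* G ^ k) ⬝ᵥ f = 0 := fun k hk => by
    rw [hqk ⟨k, by omega⟩, Pi.single_eq_of_ne]
    simp [Fin.ext_iff, hk.ne]
  have h1 : (q ᵥ* G ^ m) ⬝ᵥ f = 1 := by
    simpa using hqk (Fin.last m)
  set p : Polynomial ℝ := ∏ i, (Polynomial.X - Polynomial.C (lam i))
  have hev : ∀ i, ∃ v ≠ 0, (G - vecMulVec f (q ᵥ* Polynomial.aeval G p)) *ᵥ v = lam i • v := by
    intro i
    refine exists_eigenvector_ackermann G q f h0 h1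
      (Polynomial.monic_prod_of_monic _ _ fun i _ => Polynomial.monic_X_sub_C _) ?_ ?_
    · simp
    · rw [Polynomial.IsRoot, Polynomial.eval_prod]
      exact Finset.prod_eq_zero (Finset.mem_univ i) (by simp)
  refine ⟨replicateRow (Fin 1) (-(q ᵥ* Polynomial.aeval G p)), fun i j _ => ?_⟩
  have hM : G + F * replicateRow (Fin 1) (-(q ᵥ* Polynomial.aeval G p))
      = G - vecMulVec f (q ᵥ* Polynomial.aeval G p) := by
    ext a b
    simp [mul_apply, vecMulVec_apply, hf, sub_eq_add_neg]
  rw [hM]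
  obtain ⟨v, hv, hMv⟩ := hev i
  obtain ⟨w, hw, hMw⟩ := hev j
  refine ⟨vecMulVec v w + vecMulVec w v, vecMulVec_add_swap_ne_zero hv hw, ?_, ?_⟩
  · rw [transpose_add, transpose_vecMulVec, transpose_vecMulVec, add_comm (vecMulVec w v)]
  · rw [mul_add, add_mul, mul_vecMulVec, mul_vecMulVec, vecMulVec_mul, vecMulVec_mul,
      vecMul_transpose, vecMul_transpose, hMv, hMw]
    ext a b
    simp only [Matrix.add_apply, Matrix.smul_apply, vecMulVec_apply, Pi.smul_apply, smul_eq_mul]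
    ring
end

section
/- Let G be a real n×n matrix and F a real n×1 matrix such that the controllability matrix [F, GF, …, G^{n−1}F] is invertible. Then for every monic real polynomial p of degree n there exists a real 1×n matrix K such that the characteristic polynomial of G + F K equals p. In particular, for any real numbers λ_1, …, λ_n there exists K with characteristic polynomial of G + F K equal to ∏_{i=1}^n (X − λ_i). -/
open Matrix Polynomial

section PoleAssignment

variable {R : Type*} [CommRing R] {m : ℕ}

/-- If `q` annihilates `F, G F, …, G ^ (m - 1) F`, then state feedback does not change
`q, q G, …, q G ^ m`. -/
lemma mul_pow_add_mul_eq (G : Matrix (Fin (m + 1)) (Fin (m + 1)) R)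
    (F : Matrix (Fin (m + 1)) (Fin 1) R) (K q : Matrix (Fin 1) (Fin (m + 1)) R)
    (hq : ∀ j < m, q * (G ^ j * F) = 0) (j : ℕ) (hj : j ≤ m) :
    q * (G + F * K) ^ j = q * G ^ j := by
  induction j with
  | zero => simp
  | succ j ih =>
    have h : q * G ^ j * F = 0 := by rw [Matrix.mul_assoc, hq j (by lia)]
    rw [pow_succ, ← Matrix.mul_assoc, ih (by lia), Matrix.mul_add, ← Matrix.mul_assoc _ F K, h,
      Matrix.zero_mul, add_zero, Matrix.mul_assoc, ← pow_succ]

lemma mul_aeval_eq_of_mul_pow_eq {A G : Matrix (Fin (m + 1)) (Fin (m + 1)) R}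
    {q : Matrix (Fin 1) (Fin (m + 1)) R} (h : ∀ j ≤ m, q * A ^ j = q * G ^ j)
    (s : R[X]) (hs : s.natDegree < m + 1) : q * aeval A s = q * aeval G s := by
  rw [aeval_eq_sum_range' hs, aeval_eq_sum_range' hs, Matrix.mul_sum, Matrix.mul_sum]
  refine Finset.sum_congr rfl fun j hj => ?_
  rw [Matrix.mul_smul, Matrix.mul_smul, h j (by simpa [Nat.lt_succ_iff] using hj)]

/-- If `q` is dual to the last vector of the chain `F, G F, …, G ^ m F`, a polynomial `s` of
degree at most `m` with `q * s(G) = 0` vanishes. -/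
lemma eq_zero_of_mul_aeval_eq_zero {G : Matrix (Fin (m + 1)) (Fin (m + 1)) R}
    {F : Matrix (Fin (m + 1)) (Fin 1) R} {q : Matrix (Fin 1) (Fin (m + 1)) R}
    (hq : ∀ j < m, q * (G ^ j * F) = 0) (hqm : q * (G ^ m * F) = 1)
    {s : R[X]} (hs : s.natDegree < m + 1) (h : q * aeval G s = 0) : s = 0 := by
  have key : q * aeval G s * (G ^ (m - s.natDegree) * F) = s.leadingCoeff • 1 := by
    rw [aeval_eq_sum_range, Matrix.mul_sum, Matrix.sum_mul, Finset.sum_range_succ,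
      Finset.sum_eq_zero, zero_add]
    · rw [Matrix.mul_smul, Matrix.smul_mul, Matrix.mul_assoc, ← Matrix.mul_assoc (G ^ _),
        ← pow_add, show s.natDegree + (m - s.natDegree) = m by lia, hqm, coeff_natDegree]
    · intro j hj
      have hj := Finset.mem_range.mp hj
      rw [Matrix.mul_smul, Matrix.smul_mul, Matrix.mul_assoc, ← Matrix.mul_assoc (G ^ _),
        ← pow_add, hq _ (by lia), smul_zero]
  rw [h, Matrix.zero_mul] at key
  simpa using (congrFun (congrFun key 0) 0).symm

/-- Ackermann's formula: the gain `K = -q p(G)` assigns the characteristic polynomial `p`. -/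
lemma charpoly_add_mul_neg_mul_aeval [Nontrivial R] {G : Matrix (Fin (m + 1)) (Fin (m + 1)) R}
    {F : Matrix (Fin (m + 1)) (Fin 1) R} {q : Matrix (Fin 1) (Fin (m + 1)) R}
    (hq : ∀ j < m, q * (G ^ j * F) = 0) (hqm : q * (G ^ m * F) = 1)
    {p : R[X]} (hp : p.Monic) (hpd : p.natDegree = m + 1) :
    (G + F * -(q * aeval G p)).charpoly = p := by
  set K := -(q * aeval G p) with hK
  set A := G + F * K with hA
  have hpow : ∀ j ≤ m, q * A ^ j = q * G ^ j := mul_pow_add_mul_eq G F K q hq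
  have hlast : q * A ^ (m + 1) = q * G ^ (m + 1) + K := by
    rw [pow_succ, ← Matrix.mul_assoc, hpow m le_rfl, hA, Matrix.mul_add, ← Matrix.mul_assoc _ F K,
      Matrix.mul_assoc q _ F, hqm, Matrix.one_mul, Matrix.mul_assoc, ← pow_succ]
  have hpA : q * aeval A p = 0 := by
    have hlt : (p.eraseLead).natDegree < m + 1 :=
      lt_of_le_of_lt (eraseLead_natDegree_le p) (by lia)
    have hsplit (B : Matrix (Fin (m + 1)) (Fin (m + 1)) R) :
        q * aeval B p = q * aeval B p.eraseLead + q * B ^ (m + 1) := by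
      conv_lhs => rw [← eraseLead_add_C_mul_X_pow p, hp.leadingCoeff, hpd]
      simp [Matrix.mul_add]
    rw [hsplit A, mul_aeval_eq_of_mul_pow_eq hpow _ hlt, hlast, ← add_assoc, ← hsplit G, hK,
      add_neg_cancel]
  have hdeg : (A.charpoly - p).natDegree < m + 1 :=
    IsMonicOfDegree.natDegree_sub_lt m.succ_ne_zero
      ⟨by rw [charpoly_natDegree_eq_dim, Fintype.card_fin], A.charpoly_monic⟩ ⟨hpd, hp⟩
  refine sub_eq_zero.mp (eq_zero_of_mul_aeval_eq_zero hq hqm hdeg ?_)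
  rw [← mul_aeval_eq_of_mul_pow_eq hpow _ hdeg, map_sub, aeval_self_charpoly, zero_sub,
    Matrix.mul_neg, hpA, neg_zero]

/-- If the controllability matrix is invertible, there is a row vector dual to the last vector of
the chain `F, G F, …, G ^ m F`. -/
lemma exists_dual_last_of_controllable {G : Matrix (Fin (m + 1)) (Fin (m + 1)) R}
    {F : Matrix (Fin (m + 1)) (Fin 1) R}
    (hctrb : IsUnit (Matrix.of fun i j : Fin (m + 1) => ((G ^ (j : ℕ)) * F) i 0)) :
    ∃ q : Matrix (Fin 1) (Fin (m + 1)) R,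
      (∀ j < m, q * (G ^ j * F) = 0) ∧ q * (G ^ m * F) = 1 := by
  obtain ⟨B, hB⟩ := hctrb.exists_left_inv
  have hentry (j : Fin (m + 1)) :
      (Matrix.of fun _ : Fin 1 => B (Fin.last m)) * (G ^ (j : ℕ) * F) =
        Matrix.of fun _ _ => (1 : Matrix (Fin (m + 1)) (Fin (m + 1)) R) (Fin.last m) j := by
    ext a b
    rw [← hB, Subsingleton.elim b 0]
    simp [Matrix.mul_apply]
  refine ⟨Matrix.of fun _ => B (Fin.last m), fun j hj => ?_, ?_⟩
  · have hne : Fin.last m ≠ (⟨j, by lia⟩ : Fin (m + 1)) := fun h => by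
      have := congrArg Fin.val h
      simp at this
      lia
    rw [hentry ⟨j, by lia⟩, Matrix.one_apply_ne hne]
    rfl
  · refine (hentry (Fin.last m)).trans ?_
    ext a b
    rw [Subsingleton.elim a b]
    simp

end PoleAssignment

/-- If the controllability matrix of the single-input pair (G, F) is
invertible, then every monic real polynomial of degree n is the characteristic
polynomial of G + F K for some gain K; in particular any prescribed real poles
λ₁, …, λₙ can be assigned. -/
theorem pole_assignment_of_controllable
    (n : ℕ) (G : Matrix (Fin n) (Fin n) ℝ) (F : Matrix (Fin n) (Fin 1) ℝ)
    (hctrb : IsUnit (Matrix.of fun i j : Fin n => ((G ^ (j : ℕ)) * F) i 0)) :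
    (∀ p : Polynomial ℝ, p.Monic → p.natDegree = n →
      ∃ K : Matrix (Fin 1) (Fin n) ℝ, (G + F * K).charpoly = p) ∧
    (∀ lam : Fin n → ℝ, ∃ K : Matrix (Fin 1) (Fin n) ℝ,
      (G + F * K).charpoly = ∏ i, (X - C (lam i))) := by
  have main : ∀ p : Polynomial ℝ, p.Monic → p.natDegree = n →
      ∃ K : Matrix (Fin 1) (Fin n) ℝ, (G + F * K).charpoly = p := by
    intro p hp hpd
    cases n with
    | zero => exact ⟨0, by rw [charpoly_isEmpty, hp.natDegree_eq_zero.mp hpd]⟩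
    | succ m =>
      obtain ⟨q, hq, hqm⟩ := exists_dual_last_of_controllable hctrb
      exact ⟨_, charpoly_add_mul_neg_mul_aeval hq hqm hp hpd⟩
  refine ⟨main, fun lam => main _ (monic_prod_X_sub_C lam Finset.univ) ?_⟩
  rw [natDegree_finsetProd_X_sub_C_eq_card, Finset.card_univ, Fintype.card_fin]
end

section
/- Let G be a real n×n matrix and F a real n×1 matrix such that the controllability matrix C = [F, GF, …, G^{n−1}F] is invertible. Let λ_1, …, λ_n be real numbers and write ∏_{i=1}^n (β − λ_i) = β^n + a*_{n−1} β^{n−1} + ⋯ + a*_1 β + a*_0. Define the row vector b = −[0, …, 0, 1]·C^{−1}, the matrix D whose rows (top to bottom) are b G^{n−1}, …, b G, b, and the row vector a = [a*_{n−1}, …, a*_1, a*_0]. Then the feedback gain K_v = a D + b G^n satisfies: the characteristic polynomial of G + F K_v equals β^n + a*_{n−1} β^{n−1} + ⋯ + a*_1 β + a*_0 = ∏_{i=1}^n (β − λ_i). -/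
open Matrix Polynomial

/-- If `b G^j F` vanishes for `j < n - 1`, then the feedback `G + F K` does not change the rows
`b G^k` for `k < n`. -/
theorem row_mul_pow_feedback {R : Type*} [CommRing R] {n : ℕ}
    {G : Matrix (Fin n) (Fin n) R} {F : Matrix (Fin n) (Fin 1) R} {b : Matrix (Fin 1) (Fin n) R}
    (hzero : ∀ j, j + 1 < n → b * G ^ j * F = 0) (K : Matrix (Fin 1) (Fin n) R) :
    ∀ k, k < n → b * (G + F * K) ^ k = b * G ^ k := by
  intro k
  induction k with
  | zero => simp
  | succ k ih =>
    intro hk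
    rw [pow_succ, ← Matrix.mul_assoc, ih (by omega), Matrix.mul_add, ← Matrix.mul_assoc _ F K,
      hzero k hk, Matrix.zero_mul, add_zero, Matrix.mul_assoc, ← pow_succ]

theorem row_mul_aeval {R : Type*} [CommRing R] {n : ℕ} (b : Matrix (Fin 1) (Fin n) R)
    (A : Matrix (Fin n) (Fin n) R) {q : R[X]} {m : ℕ} (hq : q.natDegree < m) :
    b * aeval A q = ∑ k ∈ Finset.range m, q.coeff k • (b * A ^ k) := by
  simp [aeval_eq_sum_range' hq, Matrix.mul_sum]

/-- If `b G^j F` vanishes for `j < n - 1` and equals `-1` for `j = n - 1`, then the rows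
`b, b G, …, b G^(n-1)` are linearly independent. -/
theorem eq_zero_of_row_mul_aeval_eq_zero {R : Type*} [CommRing R] {n : ℕ}
    {G : Matrix (Fin n) (Fin n) R} {F : Matrix (Fin n) (Fin 1) R} {b : Matrix (Fin 1) (Fin n) R}
    (hzero : ∀ j, j + 1 < n → b * G ^ j * F = 0) (hlast : b * G ^ (n - 1) * F = -1)
    {q : R[X]} (hq : q.natDegree < n) (h : b * aeval G q = 0) : q = 0 := by
  rw [row_mul_aeval b G (Nat.lt_succ_self _), Finset.sum_range_succ] at h
  have h' := congrArg (fun M => M * (G ^ (n - 1 - q.natDegree) * F)) h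
  have hexp : q.natDegree + (n - 1 - q.natDegree) = n - 1 := by omega
  have hsum : ∀ k ∈ Finset.range q.natDegree,
      q.coeff k • (b * G ^ k) * (G ^ (n - 1 - q.natDegree) * F) = 0 := by
    intro k hk
    rw [Finset.mem_range] at hk
    rw [Matrix.smul_mul, ← Matrix.mul_assoc, Matrix.mul_assoc b, ← pow_add,
      hzero _ (by omega), smul_zero]
  simp only [Matrix.add_mul, Matrix.sum_mul, Matrix.zero_mul] at h'
  rw [Finset.sum_eq_zero hsum, zero_add, Matrix.smul_mul, ← Matrix.mul_assoc, Matrix.mul_assoc b,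
    ← pow_add, hexp, hlast] at h'
  have := congrFun (congrFun h' 0) 0
  simpa using this

/-- Pole placement by the gain `b p(G)`, for a row `b` that picks out the last entry of the
controllability chain up to sign. -/
theorem charpoly_add_mul_row_mul_aeval {R : Type*} [CommRing R] [Nontrivial R] {n : ℕ} (hn : 0 < n)
    {G : Matrix (Fin n) (Fin n) R} {F : Matrix (Fin n) (Fin 1) R} {b : Matrix (Fin 1) (Fin n) R}
    (hzero : ∀ j, j + 1 < n → b * G ^ j * F = 0) (hlast : b * G ^ (n - 1) * F = -1)
    {p : R[X]} (hp : p.Monic) (hdeg : p.natDegree = n) :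
    (G + F * (b * aeval G p)).charpoly = p := by
  set K := b * aeval G p with hK
  set A := G + F * K with hA
  have hpow : ∀ k, k < n → b * A ^ k = b * G ^ k := row_mul_pow_feedback hzero K
  have hpow_n : b * A ^ n = b * G ^ n - K := by
    obtain ⟨m, rfl⟩ : ∃ m, n = m + 1 := ⟨n - 1, by omega⟩
    rw [Nat.add_sub_cancel] at hlast
    rw [pow_succ, ← Matrix.mul_assoc, hpow m (by omega), hA, Matrix.mul_add,
      ← Matrix.mul_assoc _ F K, hlast, Matrix.neg_mul, Matrix.one_mul, Matrix.mul_assoc,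
      ← pow_succ, sub_eq_add_neg]
  have hcoeff : p.coeff n = 1 := hdeg ▸ hp.coeff_natDegree
  have hpA : b * aeval A p = 0 := by
    have hKsum := row_mul_aeval b G (q := p) (m := n + 1) (by omega)
    rw [← hK, Finset.sum_range_succ, hcoeff, one_smul] at hKsum
    rw [row_mul_aeval b A (m := n + 1) (by omega), Finset.sum_range_succ, hcoeff, one_smul, hpow_n,
      Finset.sum_congr rfl fun k hk => by rw [hpow k (Finset.mem_range.mp hk)], ← add_sub_assoc,
      ← hKsum, sub_self]
  have hAdeg : A.charpoly.natDegree = n := by simp [Matrix.charpoly_natDegree_eq_dim]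
  have hlt : (A.charpoly - p).natDegree < n := by
    have hd : (A.charpoly - p).degree < A.charpoly.degree :=
      degree_sub_lt_left (by rw [degree_eq_natDegree A.charpoly_monic.ne_zero,
        degree_eq_natDegree hp.ne_zero, hAdeg, hdeg]) A.charpoly_monic.ne_zero
        (by rw [A.charpoly_monic.leadingCoeff, hp.leadingCoeff])
    rw [degree_eq_natDegree A.charpoly_monic.ne_zero, hAdeg] at hd
    rcases eq_or_ne (A.charpoly - p) 0 with h0 | h0
    · rwa [h0, natDegree_zero]
    · exact (natDegree_lt_iff_degree_lt h0).mpr hd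
  refine sub_eq_zero.mp (eq_zero_of_row_mul_aeval_eq_zero hzero hlast hlt ?_)
  rw [row_mul_aeval b G hlt,
    ← Finset.sum_congr rfl fun k hk => congrArg (_ • ·) (hpow k (Finset.mem_range.mp hk)),
    ← row_mul_aeval b A hlt, map_sub, Matrix.aeval_self_charpoly, zero_sub, Matrix.mul_neg, hpA,
    neg_zero]

open Matrix Polynomial

/-- Ackermann's formula.  With C the (invertible) controllability
matrix of (G, F), b = -[0 … 0 1]·C⁻¹, D the matrix with rows bG^{n-1}, …, bG, b,
and a = [a*_{n-1}, …, a*_1, a*_0] the coefficients of ∏ᵢ (β - λᵢ), the gain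
K_v = aD + bGⁿ places the characteristic polynomial of G + F K_v at ∏ᵢ (β - λᵢ). -/
theorem ackermann_formula
    (n : ℕ) (hn : 0 < n)
    (G : Matrix (Fin n) (Fin n) ℝ) (F : Matrix (Fin n) (Fin 1) ℝ)
    (Ctrb : Matrix (Fin n) (Fin n) ℝ)
    (hCtrb : Ctrb = Matrix.of fun i j : Fin n => ((G ^ (j : ℕ)) * F) i 0)
    (hCu : IsUnit Ctrb)
    (lam : Fin n → ℝ)
    (p : Polynomial ℝ) (hp : p = ∏ i, (X - C (lam i)))
    (b : Matrix (Fin 1) (Fin n) ℝ)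
    (hb : b = -((Matrix.of fun (_ : Fin 1) (j : Fin n) =>
      if (j : ℕ) = n - 1 then (1 : ℝ) else 0) * Ctrb⁻¹))
    (D : Matrix (Fin n) (Fin n) ℝ)
    (hD : D = Matrix.of fun i j : Fin n => (b * G ^ (n - 1 - (i : ℕ))) 0 j)
    (a : Matrix (Fin 1) (Fin n) ℝ)
    (ha : a = Matrix.of fun (_ : Fin 1) (j : Fin n) => p.coeff (n - 1 - (j : ℕ))) :
    (G + F * (a * D + b * G ^ n)).charpoly = p := by
  have hchain : ∀ j, j < n → b * G ^ j * F = if j = n - 1 then -1 else 0 := by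
    intro j hj
    have hbC : b * Ctrb = -(Matrix.of fun (_ : Fin 1) (j : Fin n) =>
        if (j : ℕ) = n - 1 then (1 : ℝ) else 0) := by
      rw [hb, Matrix.neg_mul, Matrix.mul_assoc,
        Matrix.nonsing_inv_mul _ ((Matrix.isUnit_iff_isUnit_det _).mp hCu), Matrix.mul_one]
    ext s t
    obtain rfl := Subsingleton.elim s 0
    obtain rfl := Subsingleton.elim t 0
    have hentry := congrFun (congrFun hbC 0) ⟨j, hj⟩
    rw [hCtrb] at hentry
    rw [Matrix.mul_assoc]
    refine Eq.trans ?_ (hentry.trans ?_)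
    · simp [Matrix.mul_apply]
    · by_cases h : j = n - 1 <;> simp [h]
  have hmonic : p.Monic := hp ▸ monic_prod_of_monic _ _ fun i _ => monic_X_sub_C _
  have hdeg : p.natDegree = n := by
    rw [hp, natDegree_prod_of_monic _ _ fun i _ => monic_X_sub_C _]
    simp
  have hgain : a * D + b * G ^ n = b * aeval G p := by
    have hcoeff : p.coeff n = 1 := hdeg ▸ hmonic.coeff_natDegree
    rw [row_mul_aeval b G (m := n + 1) (by omega), Finset.sum_range_succ, hcoeff, one_smul,
      ← Finset.sum_range_reflect, ← Fin.sum_univ_eq_sum_range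
        (fun k => p.coeff (n - 1 - k) • (b * G ^ (n - 1 - k)))]
    congr 1
    ext s t
    obtain rfl := Subsingleton.elim s 0
    rw [Matrix.mul_apply, Matrix.sum_apply, ha, hD]
    rfl
  rw [hgain]
  refine charpoly_add_mul_row_mul_aeval hn (fun j hj => ?_) ?_ hmonic hdeg
  · rw [hchain j (by omega), if_neg (by omega)]
  · rw [hchain _ (by omega), if_pos rfl]
end

section
/- Let G be a real n×n matrix and F a real n×1 matrix such that the controllability matrix [F, GF, …, G^{n−1}F] is invertible, and let λ_1, …, λ_n be real numbers. Then there exist a real 1×n matrix K_v and nonzero vectors ξ_1, …, ξ_n ∈ ℝⁿ such that (G + F K_v) ξ_i = λ_i ξ_i for every i = 1, …, n. -/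
open Matrix

open Polynomial in
/-- If the row vector `w` satisfies `w G ^ j F = 0` for `j < m` and `w G ^ m F = 1`, then
`w q(G) F = 1` for every monic polynomial `q` of degree `m`. -/
theorem dotProduct_aeval_mulVec_of_monic {K ι : Type*} [CommRing K] [Fintype ι] [DecidableEq ι]
    {m : ℕ} {G : Matrix ι ι K} {f w : ι → K}
    (hw : ∀ j ≤ m, w ⬝ᵥ (G ^ j *ᵥ f) = if j = m then 1 else 0)
    {q : K[X]} (hq : q.Monic) (hdeg : q.natDegree = m) :
    w ⬝ᵥ (aeval G q *ᵥ f) = 1 := by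
  rw [aeval_eq_sum_range, Matrix.sum_mulVec, dotProduct_sum, hdeg,
    Finset.sum_eq_single_of_mem m (by simp)]
  · rw [smul_mulVec, dotProduct_smul, hw m le_rfl, ← hdeg, hq.coeff_natDegree]
    simp
  · intro j hj hjm
    rw [smul_mulVec, dotProduct_smul, hw j (by simpa [Nat.lt_succ_iff] using hj), if_neg hjm,
      smul_zero]

/-- A matrix over a field with a left eigenvector for `a` has a right eigenvector for `a`. -/
theorem exists_mulVec_eq_smul_of_vecMul_eq_smul {K ι : Type*} [Field K] [Fintype ι]
    {A : Matrix ι ι K} {a : K} {u : ι → K} (hu : u ≠ 0)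
    (h : u ᵥ* A = a • u) : ∃ v : ι → K, v ≠ 0 ∧ A *ᵥ v = a • v := by
  classical
  have hdet : (A - a • (1 : Matrix ι ι K)).det = 0 :=
    exists_vecMul_eq_zero_iff.mp ⟨u, hu, by
      rw [vecMul_sub, h, vecMul_smul, vecMul_one, sub_self]⟩
  obtain ⟨v, hv, hAv⟩ := exists_mulVec_eq_zero_iff.mpr hdet
  refine ⟨v, hv, ?_⟩
  rwa [sub_mulVec, smul_mulVec, one_mulVec, sub_eq_zero] at hAv

/-- If the controllability matrix of (G, F) is invertible, then for
any real λ₁, …, λₙ there exist a gain K_v and nonzero vectors ξ₁, …, ξₙ with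
(G + F K_v) ξᵢ = λᵢ ξᵢ for every i. -/
theorem eigenvector_assignment_of_controllable
    (n : ℕ) (G : Matrix (Fin n) (Fin n) ℝ) (F : Matrix (Fin n) (Fin 1) ℝ)
    (hctrb : IsUnit (Matrix.of fun i j : Fin n => ((G ^ (j : ℕ)) * F) i 0))
    (lam : Fin n → ℝ) :
    ∃ Kv : Matrix (Fin 1) (Fin n) ℝ, ∃ ξ : Fin n → (Fin n → ℝ),
      ∀ i : Fin n, ξ i ≠ 0 ∧ (G + F * Kv).mulVec (ξ i) = lam i • ξ i := by
  rcases n with _ | m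
  · exact ⟨0, 0, fun i => i.elim0⟩
  obtain ⟨w, hwC⟩ := (vecMul_surjective_iff_isUnit.mpr hctrb) (Pi.single (Fin.last m) 1)
  set f : Fin (m + 1) → ℝ := fun i => F i 0 with hf
  have hw : ∀ j ≤ m, w ⬝ᵥ (G ^ j *ᵥ f) = if j = m then 1 else 0 := by
    intro j hj
    have := congrFun hwC ⟨j, Nat.lt_succ_of_le hj⟩
    simp only [Pi.single_apply, Fin.ext_iff, Fin.val_last] at this
    exact this
  -- The Ackermann gain `-w p(G)` with `p = ∏ (X - λᵢ)`
  let p : Polynomial ℝ := ∏ i, (Polynomial.X - Polynomial.C (lam i))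
  let k : Fin (m + 1) → ℝ := -(w ᵥ* Polynomial.aeval G p)
  refine ⟨replicateRow (Fin 1) k, ?_⟩
  suffices h : ∀ i, ∃ v : Fin (m + 1) → ℝ, v ≠ 0 ∧
      (G + F * replicateRow (Fin 1) k) *ᵥ v = lam i • v by
    choose ξ hξ using h
    exact ⟨ξ, hξ⟩
  intro i
  let q : Polynomial ℝ := ∏ j ∈ Finset.univ.erase i, (Polynomial.X - Polynomial.C (lam j))
  have hpq : p = q * (Polynomial.X - Polynomial.C (lam i)) :=
    (Finset.prod_erase_mul _ _ (Finset.mem_univ i)).symm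
  have hu : (w ᵥ* Polynomial.aeval G q) ⬝ᵥ f = 1 := by
    rw [← dotProduct_mulVec]
    exact dotProduct_aeval_mulVec_of_monic hw (Polynomial.monic_prod_X_sub_C _ _)
      (by simp [q, Polynomial.natDegree_finsetProd_X_sub_C_eq_card])
  refine exists_mulVec_eq_smul_of_vecMul_eq_smul (u := w ᵥ* Polynomial.aeval G q) ?_ ?_
  · intro h0
    simp [h0] at hu
  · have hF : F * replicateRow (Fin 1) k = vecMulVec f k := by
      ext a b
      simp [Matrix.mul_apply, vecMulVec_apply, hf]
    have hk : k = lam i • (w ᵥ* Polynomial.aeval G q) - w ᵥ* Polynomial.aeval G q ᵥ* G := by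
      simp only [k, hpq, map_mul, map_sub, Polynomial.aeval_X, Polynomial.aeval_C,
        ← vecMul_vecMul, vecMul_sub, Algebra.algebraMap_eq_smul_one, vecMul_smul, vecMul_one,
        neg_sub]
    rw [vecMul_add, hF, vecMul_vecMulVec, hu, one_smul, hk, add_sub_cancel]
end

section
/- Let H, L be real n×n matrices, F a real n×1 matrix, K_v a real 1×n matrix, α ∈ ℝ, and set M = H + αL + F K_v. If X is a nonzero symmetric complex n×n matrix and μ ∈ ℂ satisfies M X Mᵀ + α² X = μ X, then there exist eigenvalues λ and ρ of M such that μ = λ ρ + α². That is, under the gain K_u = αI, every element of the spectrum of the discrete-time closed-loop operator has the form λ_i λ_j + α² for eigenvalues λ_i, λ_j of the closed-loop matrix H + αL + F K_v. -/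
open Matrix

/-- An endomorphism over an algebraically closed field has an eigenvector in every nonzero
finite-dimensional invariant subspace. -/
theorem Module.End.exists_hasEigenvector_mem {K V : Type*} [Field K] [IsAlgClosed K]
    [AddCommGroup V] [Module K V] [FiniteDimensional K V] (f : Module.End K V)
    {p : Submodule K V} (hp : p ≠ ⊥) (hf : ∀ v ∈ p, f v ∈ p) :
    ∃ c : K, ∃ v ∈ p, f.HasEigenvector c v := by
  have : Nontrivial p := Submodule.nontrivial_iff_ne_bot.mpr hp
  obtain ⟨c, hc⟩ := Module.End.exists_eigenvalue (f.restrict hf)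
  obtain ⟨v, hv⟩ := hc.exists_hasEigenvector
  refine ⟨c, v, v.2, Module.End.mem_eigenspace_iff.mpr ?_, fun h => hv.2 (Subtype.ext h)⟩
  exact congrArg Subtype.val hv.apply_eq_smul

/-- Every eigenvalue of a product of two commuting endomorphisms is a product of eigenvalues with a
common eigenvector. -/
theorem Module.End.HasEigenvalue.exists_hasEigenvector_of_mul {K V : Type*} [Field K]
    [IsAlgClosed K] [AddCommGroup V] [Module K V] [FiniteDimensional K V] {f g : Module.End K V}
    {c : K} (hc : (f * g).HasEigenvalue c) (hfg : Commute f g) :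
    ∃ a b : K, ∃ v, f.HasEigenvector a v ∧ g.HasEigenvector b v ∧ c = a * b := by
  have hf : ∀ v ∈ (f * g).eigenspace c, f v ∈ (f * g).eigenspace c :=
    Module.End.mapsTo_genEigenspace_of_comm ((Commute.refl f).mul_left hfg.symm) c 1
  have hg : ∀ v ∈ (f * g).eigenspace c, g v ∈ (f * g).eigenspace c :=
    Module.End.mapsTo_genEigenspace_of_comm (hfg.mul_left (Commute.refl g)) c 1
  obtain ⟨a, v, hvc, hva⟩ := f.exists_hasEigenvector_mem hc hf
  have hne : (f * g).eigenspace c ⊓ f.eigenspace a ≠ ⊥ :=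
    (Submodule.ne_bot_iff _).mpr ⟨v, ⟨hvc, hva.1⟩, hva.2⟩
  obtain ⟨b, w, ⟨hwc, hwa⟩, hwb⟩ := g.exists_hasEigenvector_mem hne fun x hx =>
    ⟨hg x hx.1, Module.End.mapsTo_genEigenspace_of_comm hfg a 1 hx.2⟩
  refine ⟨a, b, w, ⟨hwa, hwb.2⟩, hwb, smul_left_injective K hwb.2 ?_⟩
  have h := Module.End.mem_eigenspace_iff.mp hwc
  rw [Module.End.mul_apply, hwb.apply_eq_smul, map_smul,
    Module.End.mem_eigenspace_iff.mp hwa, smul_smul, mul_comm b a] at h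
  exact h.symm

/-- If `A * Z = c • Z` for a nonzero matrix `Z`, then `c` is a root of the characteristic polynomial
of `A`. -/
theorem Matrix.isRoot_charpoly_of_mul_eq_smul {K m n : Type*} [Field K] [Fintype n]
    [DecidableEq n] {A : Matrix n n K} {Z : Matrix n m K} {c : K} (hZ : Z ≠ 0)
    (h : A * Z = c • Z) : A.charpoly.IsRoot c := by
  have hcol : ∃ j, Z.col j ≠ 0 := by
    by_contra! hz
    exact hZ (Matrix.ext fun i j => congrFun (hz j) i)
  obtain ⟨j, hj⟩ := hcol
  rw [← Matrix.charpoly_toLin', ← Module.End.hasEigenvalue_iff_isRoot_charpoly]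
  refine Module.End.hasEigenvalue_of_hasEigenvector
    ⟨Module.End.mem_eigenspace_iff.mpr (funext fun i => ?_), hj⟩
  exact congrFun (congrFun h i) j

/-- Every eigenvalue of `X ↦ A * X * Bᵀ` is a product of eigenvalues of `A` and `B`. -/
theorem Matrix.exists_isRoot_charpoly_of_mul_mul_transpose_eq_smul {K m n : Type*} [Field K]
    [IsAlgClosed K] [Fintype m] [DecidableEq m] [Fintype n] [DecidableEq n] {A : Matrix m m K}
    {B : Matrix n n K} {X : Matrix m n K} {c : K} (hX : X ≠ 0) (h : A * X * Bᵀ = c • X) :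
    ∃ a b : K, A.charpoly.IsRoot a ∧ B.charpoly.IsRoot b ∧ c = a * b := by
  let f : Module.End K (Matrix m n K) := mulLeftLinearMap n K A
  let g : Module.End K (Matrix m n K) := mulRightLinearMap m K Bᵀ
  have hfg : Commute f g := LinearMap.ext fun Y => (Matrix.mul_assoc A Y Bᵀ).symm
  have hc : (f * g).HasEigenvalue c := Module.End.hasEigenvalue_of_hasEigenvector
    ⟨Module.End.mem_eigenspace_iff.mpr ((Matrix.mul_assoc A X Bᵀ).symm.trans h), hX⟩
  obtain ⟨a, b, Z, ha, hb, hab⟩ := hc.exists_hasEigenvector_of_mul hfg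
  refine ⟨a, b, isRoot_charpoly_of_mul_eq_smul ha.2 ha.apply_eq_smul,
    isRoot_charpoly_of_mul_eq_smul (Z := Zᵀ) (by simpa using hb.2) ?_, hab⟩
  have hZ : Z * Bᵀ = b • Z := hb.apply_eq_smul
  simpa using congrArg transpose hZ

/-- With M = H + αL + F K_v (gain K_u = αI), every element of the
spectrum of the discrete-time closed-loop operator M X Mᵀ + α² X has the form
λρ + α² for eigenvalues λ, ρ of M. -/
theorem discrete_closed_loop_spectrum_structure
    (n : ℕ) (H L : Matrix (Fin n) (Fin n) ℝ) (F : Matrix (Fin n) (Fin 1) ℝ)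
    (Kv : Matrix (Fin 1) (Fin n) ℝ) (α : ℝ)
    (M : Matrix (Fin n) (Fin n) ℝ) (hM : M = H + α • L + F * Kv)
    (X : Matrix (Fin n) (Fin n) ℂ) (hX0 : X ≠ 0) (hXs : Xᵀ = X) (μ : ℂ)
    (h : (M.map Complex.ofReal) * X * (M.map Complex.ofReal)ᵀ
        + ((α : ℂ) ^ 2) • X = μ • X) :
    ∃ lam ρ : ℂ, (M.map Complex.ofReal).charpoly.IsRoot lam ∧
      (M.map Complex.ofReal).charpoly.IsRoot ρ ∧ μ = lam * ρ + (α : ℂ) ^ 2 := by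
  have hX : (M.map Complex.ofReal) * X * (M.map Complex.ofReal)ᵀ = (μ - (α : ℂ) ^ 2) • X := by
    rw [sub_smul, ← h, add_sub_cancel_right]
  obtain ⟨a, b, ha, hb, hab⟩ := exists_isRoot_charpoly_of_mul_mul_transpose_eq_smul hX0 hX
  exact ⟨a, b, ha, hb, sub_eq_iff_eq_add.mp hab⟩
end
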